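/- The vector μ is an extreme point of the type B/C dominant weight polytope D^{BC}_{2λ} = {ν ∈ ℝ^n : ν_1 ≥ ... ≥ ν_n ≥ 0 and Σ_{i=1}^k ν_i ≤ 2Σ_{i=1}^k λ_i for all 1 ≤ k ≤ n}. -/

import Mathlib

/-- The sum of the first `k` coordinates of `v`. -/
def prefixSum {n : ℕ} (v : Fin n → ℝ) (k : ℕ) : ℝ :=
  ∑ i : Fin n, if (i : ℕ) < k then v i else 0

lemma prefixSum_zero {n : ℕ} (v : Fin n → ℝ) : prefixSum v 0 = 0 := by
  simp [prefixSum]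

lemma prefixSum_succ {n : ℕ} (v : Fin n → ℝ) {k : ℕ} (hk : k < n) :
    prefixSum v (k + 1) = prefixSum v k + v ⟨k, hk⟩ := by
  have h : v ⟨k, hk⟩ = ∑ i : Fin n, if i = ⟨k, hk⟩ then v i else 0 := by simp
  rw [h, prefixSum, prefixSum, ← Finset.sum_add_distrib]
  refine Finset.sum_congr rfl fun i _ => ?_
  simp only [Fin.ext_iff]
  split_ifs <;> first | omega | simp

lemma prefixSum_smul_add_smul {n : ℕ} (a b : ℝ) (v w : Fin n → ℝ) (k : ℕ) :
    prefixSum (a • v + b • w) k = a * prefixSum v k + b * prefixSum w k := by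
  simp only [prefixSum, Finset.mul_sum, ← Finset.sum_add_distrib]
  refine Finset.sum_congr rfl fun i _ => ?_
  split_ifs <;> simp

/-- An upper bound attained by a proper convex combination is attained by its first term. -/
lemma eq_of_convexCombination_eq_of_le {a b u v c : ℝ} (ha : 0 < a) (hb : 0 < b)
    (hab : a + b = 1) (hu : u ≤ c) (hv : v ≤ c) (h : a * u + b * v = c) : u = c := by
  refine le_antisymm hu (le_of_mul_le_mul_left ?_ ha)
  have hbv := mul_le_mul_of_nonneg_left hv hb.le
  have hc : a * c + b * c = c := by rw [← add_mul, hab, one_mul]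
  linarith

/-- Context: n ≥ 3, λ ∈ ℝⁿ with λ_1 ≥ ... ≥ λ_n ≥ 0, 1 ≤ m ≤ n-2 (1-based), and
μ_j = (2/3)(λ_m + λ_{m+1} + λ_{m+2}) for 1-based j ∈ {m, m+1, m+2},
μ_j = 2λ_j otherwise.  (Fin n is 0-based, so 1-based index j is (j : ℕ) + 1.)
STATEMENT 15: μ is an extreme point of the type B/C dominant weight polytope
D^{BC}_{2λ} = {ν : ν_1 ≥ ... ≥ ν_n ≥ 0, Σ_{i=1}^k ν_i ≤ 2Σ_{i=1}^k λ_i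
for all 1 ≤ k ≤ n}. -/
theorem stmt15 (n m : ℕ) (hn : 3 ≤ n) (hm1 : 1 ≤ m) (hm2 : m + 2 ≤ n)
    (lam mu : Fin n → ℝ)
    (hlam : ∀ i j : Fin n, i ≤ j → lam j ≤ lam i)
    (hlam0 : 0 ≤ lam ⟨n - 1, by omega⟩)
    (hmu : ∀ j : Fin n,
      (m ≤ (j : ℕ) + 1 ∧ (j : ℕ) + 1 ≤ m + 2 →
        mu j = 2 / 3 * (lam ⟨m - 1, by omega⟩ + lam ⟨m, by omega⟩
          + lam ⟨m + 1, by omega⟩)) ∧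
      (¬(m ≤ (j : ℕ) + 1 ∧ (j : ℕ) + 1 ≤ m + 2) → mu j = 2 * lam j)) :
    mu ∈ Set.extremePoints ℝ
      {ν : Fin n → ℝ | (∀ i j : Fin n, i ≤ j → ν j ≤ ν i) ∧
        0 ≤ ν ⟨n - 1, by omega⟩ ∧
        (∀ k, 1 ≤ k → k ≤ n →
          (∑ i : Fin n, if (i : ℕ) < k then ν i else 0) ≤
            2 * ∑ i : Fin n, if (i : ℕ) < k then lam i else 0)} := by
  obtain ⟨p, rfl⟩ : ∃ p, m = p + 1 := ⟨m - 1, by omega⟩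
  simp only [Nat.add_sub_cancel] at hmu
  have h0 : p < n := by omega
  have h1 : p + 1 < n := by omega
  have h2 : p + 2 < n := by omega
  have hout : ∀ j (hj : j < n), j < p ∨ p + 3 ≤ j → mu ⟨j, hj⟩ = 2 * lam ⟨j, hj⟩ :=
    fun j hj h => (hmu ⟨j, hj⟩).2 (by simp only; omega)
  have hin : ∀ j (hj : j < n), p ≤ j → j ≤ p + 2 →
      mu ⟨j, hj⟩ = 2 / 3 * (lam ⟨p, h0⟩ + lam ⟨p + 1, h1⟩ + lam ⟨p + 2, h2⟩) :=
    fun j hj h h' => (hmu ⟨j, hj⟩).1 (by simp only; omega)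
  have hl1 : lam ⟨p + 1, h1⟩ ≤ lam ⟨p, h0⟩ := hlam _ _ (by simp)
  have hl2 : lam ⟨p + 2, h2⟩ ≤ lam ⟨p + 1, h1⟩ := hlam _ _ (by simp)
  have hlow : ∀ k ≤ p, prefixSum mu k = 2 * prefixSum lam k := by
    intro k hk
    induction k with
    | zero => simp [prefixSum_zero]
    | succ k ih =>
      have hkn : k < n := by omega
      rw [prefixSum_succ _ hkn, prefixSum_succ _ hkn, ih (by omega),
        hout k hkn (.inl (by omega))]
      ring
  have hp := hlow p le_rfl
  have hsucc (v : Fin n → ℝ) : prefixSum v (p + 1) = prefixSum v p + v ⟨p, h0⟩ ∧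
      prefixSum v (p + 2) = prefixSum v (p + 1) + v ⟨p + 1, h1⟩ ∧
      prefixSum v (p + 3) = prefixSum v (p + 2) + v ⟨p + 2, h2⟩ :=
    ⟨prefixSum_succ v h0, prefixSum_succ v h1, prefixSum_succ v h2⟩
  have hm0 := hin p h0 (by omega) (by omega)
  have hm1' := hin (p + 1) h1 (by omega) (by omega)
  have hm2' := hin (p + 2) h2 (by omega) (by omega)
  obtain ⟨hs1, hs2, hs3⟩ := hsucc mu
  obtain ⟨ht1, ht2, ht3⟩ := hsucc lam
  have hhigh : ∀ k, p + 3 ≤ k → k ≤ n → prefixSum mu k = 2 * prefixSum lam k := by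
    intro k hk
    induction k, hk using Nat.le_induction with
    | base => intro _; linarith
    | succ k hk ih =>
      intro hkn
      have hkn' : k < n := by omega
      rw [prefixSum_succ _ hkn', prefixSum_succ _ hkn', ih (by omega),
        hout k hkn' (.inr hk)]
      ring
  have htight : ∀ k ≤ n, k ≠ p + 1 → k ≠ p + 2 → prefixSum mu k = 2 * prefixSum lam k := by
    intro k hk hk1 hk2
    rcases Nat.lt_or_ge p k with h | h
    · exact hhigh k (by omega) hk
    · exact hlow k h
  rw [mem_extremePoints_iff_left]
  refine ⟨⟨?_, ?_, ?_⟩, ?_⟩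
  · rintro ⟨i, hi⟩ ⟨j, hj⟩ hij
    have hij' : i ≤ j := hij
    have hle : ∀ s t (hs : s < n) (ht : t < n), s ≤ t → lam ⟨t, ht⟩ ≤ lam ⟨s, hs⟩ :=
      fun s t hs ht hst => hlam _ _ hst
    by_cases hi' : i < p ∨ p + 3 ≤ i <;> by_cases hj' : j < p ∨ p + 3 ≤ j
    · rw [hout i hi hi', hout j hj hj']
      linarith [hle i j hi hj hij']
    · rw [hout i hi hi', hin j hj (by omega) (by omega)]
      linarith [hle i p hi h0 (by omega)]
    · rw [hin i hi (by omega) (by omega), hout j hj hj']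
      linarith [hle (p + 2) j h2 hj (by omega)]
    · rw [hin i hi (by omega) (by omega), hin j hj (by omega) (by omega)]
  · have hpos : ∀ j, 0 ≤ lam j := fun j =>
      hlam0.trans (hlam _ _ (Fin.mk_le_mk.2 (by omega) : j ≤ ⟨n - 1, by omega⟩))
    by_cases h : n - 1 < p ∨ p + 3 ≤ n - 1
    · rw [hout _ _ h]
      linarith
    · rw [hin _ _ (by omega) (by omega)]
      linarith [hpos ⟨p, h0⟩, hpos ⟨p + 1, h1⟩, hpos ⟨p + 2, h2⟩]
  · intro k _ hk
    change prefixSum mu k ≤ 2 * prefixSum lam k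
    by_cases hk1 : k = p + 1
    · subst hk1; linarith
    by_cases hk2 : k = p + 2
    · subst hk2; linarith
    exact (htight k hk hk1 hk2).le
  · rintro x ⟨hxa, -, hx⟩ y ⟨hya, -, hy⟩ ⟨a, b, ha, hb, hab, hxy⟩
    have hsum : ∀ k ≤ n, k ≠ p + 1 → k ≠ p + 2 → prefixSum x k = prefixSum mu k := by
      intro k hk hk1 hk2
      rcases Nat.eq_zero_or_pos k with rfl | hk0
      · simp [prefixSum_zero]
      have ht := htight k hk hk1 hk2
      refine eq_of_convexCombination_eq_of_le ha hb hab ?_ ?_ ?_ (v := prefixSum y k)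
      · exact ht ▸ hx k hk0 hk
      · exact ht ▸ hy k hk0 hk
      · rw [← prefixSum_smul_add_smul, hxy]
    have heq : ∀ i j : Fin n, i ≤ j → mu i = mu j → x j = x i := by
      intro i j hij hmuij
      have hi := congrFun hxy i
      have hj := congrFun hxy j
      simp only [Pi.add_apply, Pi.smul_apply, smul_eq_mul] at hi hj
      refine sub_eq_zero.1 (eq_of_convexCombination_eq_of_le ha hb hab
        (sub_nonpos.2 (hxa i j hij)) (sub_nonpos.2 (hya i j hij)) ?_)
      linarith
    have hx1 := heq ⟨p, h0⟩ ⟨p + 1, h1⟩ (by simp) (by rw [hm0, hm1'])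
    have hx2 := heq ⟨p, h0⟩ ⟨p + 2, h2⟩ (by simp) (by rw [hm0, hm2'])
    obtain ⟨hu1, hu2, hu3⟩ := hsucc x
    have hxp := hsum p (by omega) (by omega) (by omega)
    have hxp3 := hsum (p + 3) (by omega) (by omega) (by omega)
    funext ⟨j, hj⟩
    by_cases hj' : j < p ∨ p + 3 ≤ j
    · have hc := hsum j (by omega) (by omega) (by omega)
      have hd := hsum (j + 1) (by omega) (by omega) (by omega)
      rw [prefixSum_succ x hj, prefixSum_succ mu hj] at hd
      linarith
    · obtain rfl | rfl | rfl : j = p ∨ j = p + 1 ∨ j = p + 2 := by omega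
      all_goals linarith
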